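/- Let U = Σ_{i=1}^N U_i satisfy Assumption S3 with constant M̃ > 0, and let x* ∈ ℝ^d satisfy ∇U(x*) = 0. Let 1 ≤ n ≤ N and let τ be a uniform random n-subset of {1, …, N}. Then for every x ∈ ℝ^d, E_τ |(N/n)·Σ_{i∈τ}(∇U_i(x) − ∇U_i(x*)) − ∇U(x)|² ≤ 2·(N(N − n)/n)·M̃²·|x − x*|²; i.e., the control-variate stochastic gradient is unbiased and its second-moment error vanishes quadratically as x → x*. -/

import Mathlib

open Finset

/-- Each element of an `N`-element type belongs to a fraction `n / N` of its `n`-subsets. -/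
lemma card_mul_card_filter_mem_powersetCard {ι : Type*} [Fintype ι] [DecidableEq ι] {n : ℕ}
    (hn : 1 ≤ n) (i : ι) :
    (Fintype.card ι : ℝ) * #{s ∈ powersetCard n (univ : Finset ι) | i ∈ s}
      = n * (Fintype.card ι).choose n := by
  have h := card_filter_powersetCard_subset {i} univ n (subset_univ _) (by simpa using hn)
  simp only [singleton_subset_iff, card_univ, card_singleton] at h
  rw [h]
  have hN : 0 < Fintype.card ι := Fintype.card_pos_iff.mpr ⟨i⟩
  obtain ⟨N, hN'⟩ := Nat.exists_eq_add_of_le' hN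
  obtain ⟨m, rfl⟩ := Nat.exists_eq_add_of_le' hn
  rw [hN']
  have := Nat.add_one_mul_choose_eq N m
  rw [mul_comm ((m + 1 : ℕ) : ℝ)]
  exact_mod_cast this

/-- Two distinct elements of an `N`-element type belong together to a fraction
`n (n - 1) / (N (N - 1))` of its `n`-subsets. -/
lemma card_mul_card_filter_pair_mem_powersetCard {ι : Type*} [Fintype ι] [DecidableEq ι] {n : ℕ}
    (hn : 1 ≤ n) {i j : ι} (hij : i ≠ j) :
    (Fintype.card ι : ℝ) * (Fintype.card ι - 1)
        * #{s ∈ powersetCard n (univ : Finset ι) | i ∈ s ∧ j ∈ s}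
      = n * (n - 1) * (Fintype.card ι).choose n := by
  obtain rfl | hn2 := hn.eq_or_lt
  · rw [filter_eq_empty_iff.mpr]
    · simp
    · rintro s hs ⟨hi, hj⟩
      exact hij (card_le_one.mp (mem_powersetCard.mp hs).2.le i hi j hj)
  have h := card_filter_powersetCard_subset {i, j} univ n (subset_univ _)
    (by rw [card_pair hij]; exact hn2)
  simp only [insert_subset_iff, singleton_subset_iff, card_univ, card_pair hij] at h
  rw [h]
  have hN : 2 ≤ Fintype.card ι := card_pair hij ▸ card_le_univ {i, j}
  obtain ⟨N, hN'⟩ := Nat.exists_eq_add_of_le' hN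
  obtain ⟨m, rfl⟩ := Nat.exists_eq_add_of_le' (show 2 ≤ n from hn2)
  rw [hN']
  have h1 : ((N + 1 : ℕ) : ℝ) * N.choose m = (N + 1).choose (m + 1) * (m + 1 : ℕ) := by
    exact_mod_cast Nat.add_one_mul_choose_eq N m
  have h2 : ((N + 2 : ℕ) : ℝ) * (N + 1).choose (m + 1)
      = (N + 2).choose (m + 2) * (m + 2 : ℕ) := by
    exact_mod_cast Nat.add_one_mul_choose_eq (N + 1) (m + 1)
  simp only [Nat.add_sub_cancel]
  push_cast at h1 h2 ⊢
  linear_combination ((N : ℝ) + 2) * h1 + ((m : ℝ) + 1) * h2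

section SamplingWithoutReplacement

variable {ι E : Type*} [Fintype ι] [NormedAddCommGroup E] [InnerProductSpace ℝ E] {n : ℕ}

/-- First moment of the sum over a uniform random `n`-subset. -/
lemma card_smul_sum_powersetCard_sum (hn : 1 ≤ n) (a : ι → E) :
    (Fintype.card ι : ℝ) • ∑ s ∈ powersetCard n univ, ∑ i ∈ s, a i
      = ((n : ℝ) * (Fintype.card ι).choose n) • ∑ i, a i := by
  classical
  have h : ∑ s ∈ powersetCard n univ, ∑ i ∈ s, a i
      = ∑ i, (#{s ∈ powersetCard n (univ : Finset ι) | i ∈ s} : ℝ) • a i := by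
    rw [sum_comm' (t' := univ) (s' := fun i => {s ∈ powersetCard n (univ : Finset ι) | i ∈ s})
      (by simp)]
    simp [Nat.cast_smul_eq_nsmul]
  rw [h, smul_sum, smul_sum]
  refine sum_congr rfl fun i _ => ?_
  rw [smul_smul, card_mul_card_filter_mem_powersetCard hn]

/-- Second moment of the sum over a uniform random `n`-subset. -/
lemma card_mul_sum_powersetCard_norm_sq_sum (hn : 1 ≤ n) (a : ι → E) :
    (Fintype.card ι : ℝ) * (Fintype.card ι - 1) * ∑ s ∈ powersetCard n univ, ‖∑ i ∈ s, a i‖ ^ 2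
      = n * (Fintype.card ι).choose n
        * ((n - 1) * ‖∑ i, a i‖ ^ 2 + (Fintype.card ι - n) * ∑ i, ‖a i‖ ^ 2) := by
  classical
  have hsq (s : Finset ι) : ‖∑ i ∈ s, a i‖ ^ 2 = ∑ i ∈ s, ∑ j ∈ s, inner ℝ (a i) (a j) := by
    rw [← real_inner_self_eq_norm_sq, sum_inner]
    simp_rw [inner_sum]
  have h : ∑ s ∈ powersetCard n univ, ‖∑ i ∈ s, a i‖ ^ 2
      = ∑ i, ∑ j, (#{s ∈ powersetCard n (univ : Finset ι) | i ∈ s ∧ j ∈ s} : ℝ)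
          * inner ℝ (a i) (a j) := by
    simp_rw [hsq, card_filter, Nat.cast_sum, sum_mul]
    simp_rw [sum_comm (s := univ) (t := powersetCard n univ)]
    refine sum_congr rfl fun s _ => ?_
    simp [ite_and, sum_ite_mem]
  have hw (i j : ι) : (Fintype.card ι : ℝ) * (Fintype.card ι - 1)
        * (#{s ∈ powersetCard n (univ : Finset ι) | i ∈ s ∧ j ∈ s} * inner ℝ (a i) (a j))
      = n * (Fintype.card ι).choose n * ((n - 1) * inner ℝ (a i) (a j)
        + if i = j then (Fintype.card ι - n) * ‖a i‖ ^ 2 else 0) := by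
    split_ifs with hij
    · subst hij
      have := card_mul_card_filter_mem_powersetCard hn i
      simp only [and_self, real_inner_self_eq_norm_sq]
      linear_combination ((Fintype.card ι : ℝ) - 1) * ‖a i‖ ^ 2 * this
    · linear_combination inner ℝ (a i) (a j) * card_mul_card_filter_pair_mem_powersetCard hn hij
  rw [h, hsq univ]
  simp_rw [mul_sum, hw, ← mul_sum, sum_add_distrib, sum_ite_eq, mem_univ, if_true, ← mul_sum]

/-- Variance of the rescaled sum over a uniform random `n`-subset. -/
lemma sum_powersetCard_norm_sq_smul_sum_sub (hn : 1 ≤ n) (hnN : n ≤ Fintype.card ι)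
    (hN : 2 ≤ Fintype.card ι) (a : ι → E) :
    ((Fintype.card ι).choose n : ℝ)⁻¹ * ∑ s ∈ powersetCard n univ,
        ‖((Fintype.card ι : ℝ) / n) • ∑ i ∈ s, a i - ∑ i, a i‖ ^ 2
      = (Fintype.card ι - n) / (n * (Fintype.card ι - 1))
        * (Fintype.card ι * ∑ i, ‖a i‖ ^ 2 - ‖∑ i, a i‖ ^ 2) := by
  have h1 := congrArg (inner ℝ · (∑ i, a i)) (card_smul_sum_powersetCard_sum hn a)
  have h2 := card_mul_sum_powersetCard_norm_sq_sum hn a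
  simp only [real_inner_smul_left, real_inner_self_eq_norm_sq] at h1
  have hC : ((Fintype.card ι).choose n : ℝ) ≠ 0 := by
    exact_mod_cast (Nat.choose_pos hnN).ne'
  simp_rw [norm_sub_sq_real, norm_smul, mul_pow, real_inner_smul_left, Real.norm_eq_abs, sq_abs]
  rw [sum_add_distrib, sum_sub_distrib, ← mul_sum, ← mul_sum, ← mul_sum, sum_const,
    card_powersetCard, card_univ, nsmul_eq_mul, ← sum_inner]
  generalize inner ℝ (∑ s ∈ powersetCard n univ, ∑ i ∈ s, a i) (∑ i, a i) = A at *
  generalize ∑ s ∈ powersetCard n univ, ‖∑ i ∈ s, a i‖ ^ 2 = B at *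
  generalize ‖∑ i, a i‖ ^ 2 = S at *
  generalize ∑ i, ‖a i‖ ^ 2 = Q at *
  have hn0 : (n : ℝ) ≠ 0 := by positivity
  have hN' : (2 : ℝ) ≤ Fintype.card ι := by exact_mod_cast hN
  generalize (Fintype.card ι : ℝ) = N at *
  generalize ((Fintype.card ι).choose n : ℝ) = C at *
  have hN1 : N - 1 ≠ 0 := by linarith
  have hN0 : N ≠ 0 := by linarith
  have hA : A = n * C * S / N := by rw [eq_div_iff hN0]; linear_combination h1
  have hB : B = n * C * ((n - 1) * S + (N - n) * Q) / (N * (N - 1)) := by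
    rw [eq_div_iff (mul_ne_zero hN0 hN1)]; linear_combination h2
  rw [hA, hB]
  field_simp
  ring

/-- Sampling without replacement bounds the mean squared error by `2 N (N - n) / n * K ^ 2` when
every summand has norm at most `K`. -/
lemma sum_powersetCard_norm_sq_smul_sum_sub_le (hn : 1 ≤ n) (hnN : n ≤ Fintype.card ι)
    {a : ι → E} {K : ℝ} (ha : ∀ i, ‖a i‖ ≤ K) :
    ((Fintype.card ι).choose n : ℝ)⁻¹ * ∑ s ∈ powersetCard n univ,
        ‖((Fintype.card ι : ℝ) / n) • ∑ i ∈ s, a i - ∑ i, a i‖ ^ 2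
      ≤ 2 * ((Fintype.card ι : ℝ) * (Fintype.card ι - n) / n) * K ^ 2 := by
  obtain hN | hN := (hn.trans hnN).eq_or_lt
  · obtain rfl : n = 1 := by omega
    have hs : powersetCard 1 (univ : Finset ι) = {univ} := by
      rw [← powersetCard_self, card_univ, ← hN]
    simp [hs, ← hN]
  rw [sum_powersetCard_norm_sq_smul_sum_sub hn hnN hN]
  have hQ : ∑ i, ‖a i‖ ^ 2 ≤ Fintype.card ι * K ^ 2 := by
    calc ∑ i, ‖a i‖ ^ 2 ≤ ∑ _i : ι, K ^ 2 :=
          sum_le_sum fun i _ => pow_le_pow_left₀ (norm_nonneg _) (ha i) 2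
      _ = Fintype.card ι * K ^ 2 := by simp
  have hS := sq_nonneg ‖∑ i, a i‖
  have hn0 : (0 : ℝ) < n := by positivity
  have hN' : (2 : ℝ) ≤ Fintype.card ι := by exact_mod_cast hN
  have hnN' : (n : ℝ) ≤ Fintype.card ι := by exact_mod_cast hnN
  generalize (Fintype.card ι : ℝ) = N at *
  have hN1 : 0 < N - 1 := by linarith
  have hNn : 0 ≤ N - n := by linarith
  calc (N - n) / (n * (N - 1)) * (N * ∑ i, ‖a i‖ ^ 2 - ‖∑ i, a i‖ ^ 2)
      ≤ (N - n) / (n * (N - 1)) * (N * (2 * (N - 1) * K ^ 2)) := by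
        gcongr
        have : N * ∑ i, ‖a i‖ ^ 2 ≤ N * (2 * (N - 1) * K ^ 2) := by
          gcongr
          exact hQ.trans (by gcongr; linarith)
        linarith
    _ = 2 * (N * (N - n) / n) * K ^ 2 := by
        field_simp

end SamplingWithoutReplacement

lemma gradient_fun_sum {ι F : Type*} [NormedAddCommGroup F] [InnerProductSpace ℝ F]
    [CompleteSpace F] {u : Finset ι} {f : ι → F → ℝ} {x : F}
    (hf : ∀ i ∈ u, DifferentiableAt ℝ (f i) x) :
    gradient (fun z => ∑ i ∈ u, f i z) x = ∑ i ∈ u, gradient (f i) x := by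
  simp only [gradient, fderiv_fun_sum hf, map_sum]



/-- Second moment of the control-variate stochastic-gradient error under Assumption S3: with
`U = ∑ᵢ Uᵢ`, each `∇Uᵢ` being `M̃`-Lipschitz, `∇U(x*) = 0`, and `τ` a uniform random `n`-subset
of `{1, …, N}` (modelled as the average over all `n`-element subsets of `Fin N`),
`E_τ |(N/n)·∑_{i∈τ}(∇Uᵢ(x) − ∇Uᵢ(x*)) − ∇U(x)|² ≤ 2·(N(N−n)/n)·M̃²·|x − x*|²`. -/
theorem cv_subsampled_gradient_second_moment
    {d N : ℕ} (U : Fin N → EuclideanSpace ℝ (Fin d) → ℝ)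
    (hU : ∀ i, Differentiable ℝ (U i))
    (Mt : ℝ) (hMt : 0 < Mt)
    (hS3 : ∀ i, ∀ x y : EuclideanSpace ℝ (Fin d),
      ‖gradient (U i) x - gradient (U i) y‖ ≤ Mt * ‖x - y‖)
    (xstar : EuclideanSpace ℝ (Fin d)) (hxstar : gradient (fun z => ∑ i, U i z) xstar = 0)
    (n : ℕ) (hn1 : 1 ≤ n) (hnN : n ≤ N) (x : EuclideanSpace ℝ (Fin d)) :
    (N.choose n : ℝ)⁻¹ *
        ∑ s ∈ Finset.powersetCard n (Finset.univ : Finset (Fin N)),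
          ‖((N : ℝ) / n) • (∑ i ∈ s, (gradient (U i) x - gradient (U i) xstar))
              - gradient (fun z => ∑ i, U i z) x‖ ^ 2
      ≤ 2 * ((N : ℝ) * ((N : ℝ) - n) / n) * Mt ^ 2 * ‖x - xstar‖ ^ 2 := by
  have hgrad (y : EuclideanSpace ℝ (Fin d)) :
      gradient (fun z => ∑ i, U i z) y = ∑ i, gradient (U i) y :=
    gradient_fun_sum fun i _ => hU i y
  have hx : gradient (fun z => ∑ i, U i z) x
      = ∑ i, (gradient (U i) x - gradient (U i) xstar) := by
    rw [sum_sub_distrib, ← hgrad, ← hgrad, hxstar, sub_zero]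
  have h := sum_powersetCard_norm_sq_smul_sum_sub_le (n := n) hn1 (by simpa using hnN)
    (fun i => hS3 i x xstar)
  rw [Fintype.card_fin, mul_pow, ← mul_assoc] at h
  rw [hx]
  exact h
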